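/- Let n ≥ 1 and let ξ ∈ F_q((T^{-1})) be not algebraic of degree at most n. Then w_n^*(ξ) ≥ ŵ_n(ξ) / (ŵ_n(ξ) − n + 1). -/

import Mathlib

open Polynomial
open scoped Classical

namespace MahlerKoksmaFq

noncomputable section

variable (Fq : Type) [Field Fq] [Fintype Fq]

/-- `K Fq` models `F_q((T⁻¹))`: Laurent series in the variable `t = T⁻¹`. -/
abbrev K := LaurentSeries Fq

/-- The element `T` (the inverse of the Laurent-series variable `t = T⁻¹`). -/
def Tvar : K Fq := HahnSeries.single (-1 : ℤ) 1

/-- The absolute value `|ξ| = q^{-ν(ξ)}` on `F_q((T⁻¹))`. -/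
def absK (ξ : K Fq) : ℝ :=
  if ξ = 0 then 0 else (Fintype.card Fq : ℝ) ^ (-(HahnSeries.order ξ))

/-- The embedding of `F_q[T]` into `F_q((T⁻¹))`, sending `T` to `Tvar`. -/
def emb : Polynomial Fq →+* K Fq :=
  Polynomial.eval₂RingHom (algebraMap Fq (K Fq)) (Tvar Fq)

/-- Evaluation of `P ∈ F_q[T][X]` at `ξ ∈ F_q((T⁻¹))`. -/
def evalK (P : Polynomial (Polynomial Fq)) (ξ : K Fq) : K Fq :=
  P.eval₂ (emb Fq) ξ

/-- Height of a polynomial over `F_q[T]`: the maximum of the absolute values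
`q^{deg c}` of its coefficients. -/
def HP (P : Polynomial (Polynomial Fq)) : ℝ :=
  (Fintype.card Fq : ℝ) ^ (P.support.sup fun i => (P.coeff i).natDegree)

/-- `ξ` is algebraic (over `F_q[T]`) of degree at most `n`. -/
def IsAlgDegLe (ξ : K Fq) (n : ℕ) : Prop :=
  ∃ P : Polynomial (Polynomial Fq), P ≠ 0 ∧ P.natDegree ≤ n ∧ evalK Fq P ξ = 0

/-- `ξ` is algebraic over `F_q[T]`. -/
def IsAlgK (ξ : K Fq) : Prop :=
  ∃ P : Polynomial (Polynomial Fq), P ≠ 0 ∧ evalK Fq P ξ = 0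

/-- The degree of an algebraic element of `F_q((T⁻¹))`. -/
def degA (α : K Fq) : ℕ :=
  sInf {d | ∃ P : Polynomial (Polynomial Fq), P ≠ 0 ∧ P.natDegree = d ∧ evalK Fq P α = 0}

/-- The height of an algebraic element `α` of `F_q((T⁻¹))`: the least height of a
 nonzero annihilating polynomial of minimal degree (= height of the minimal
 defining polynomial over `F_q[T]`). -/
def HA (α : K Fq) : ℝ :=
  sInf {h | ∃ P : Polynomial (Polynomial Fq),
    P ≠ 0 ∧ P.natDegree = degA Fq α ∧ evalK Fq P α = 0 ∧ h = HP Fq P}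

/-- The defining set for Mahler's exponent `w_n`. -/
def wnSet (ξ : K Fq) (n : ℕ) : Set ℝ :=
  {w | {P : Polynomial (Polynomial Fq) |
      P.natDegree ≤ n ∧ 0 < absK Fq (evalK Fq P ξ) ∧
      absK Fq (evalK Fq P ξ) < HP Fq P ^ (-w)}.Infinite}

/-- Mahler's exponent `w_n(ξ)`. -/
def wn (ξ : K Fq) (n : ℕ) : EReal :=
  sSup ((fun w : ℝ => (w : EReal)) '' wnSet Fq ξ n)

/-- The defining set for `w_n^{sep}` (separable polynomials only). -/
def wnsepSet (ξ : K Fq) (n : ℕ) : Set ℝ :=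
  {w | {P : Polynomial (Polynomial Fq) |
      P.Separable ∧ P.natDegree ≤ n ∧ 0 < absK Fq (evalK Fq P ξ) ∧
      absK Fq (evalK Fq P ξ) < HP Fq P ^ (-w)}.Infinite}

/-- The exponent `w_n^{sep}(ξ)`. -/
def wnsep (ξ : K Fq) (n : ℕ) : EReal :=
  sSup ((fun w : ℝ => (w : EReal)) '' wnsepSet Fq ξ n)

/-- The defining set for Koksma's exponent `w_n^*` (approximation by algebraic
elements lying in `F_q((T⁻¹))`). -/
def wnstarSet (ξ : K Fq) (n : ℕ) : Set ℝ :=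
  {w | {α : K Fq | IsAlgK Fq α ∧ degA Fq α ≤ n ∧ 0 < absK Fq (ξ - α) ∧
      absK Fq (ξ - α) < HA Fq α ^ (-w - 1)}.Infinite}

/-- Koksma's exponent `w_n^*(ξ)`. -/
def wnstar (ξ : K Fq) (n : ℕ) : EReal :=
  sSup ((fun w : ℝ => (w : EReal)) '' wnstarSet Fq ξ n)

/-- The defining set for the uniform exponent `ŵ_n`. -/
def hwnSet (ξ : K Fq) (n : ℕ) : Set ℝ :=
  {w | ∃ H0 : ℝ, ∀ H : ℝ, H0 < H → ∃ P : Polynomial (Polynomial Fq),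
      P.natDegree ≤ n ∧ HP Fq P ≤ H ∧ 0 < absK Fq (evalK Fq P ξ) ∧
      absK Fq (evalK Fq P ξ) < H ^ (-w)}

/-- The uniform exponent `ŵ_n(ξ)`. -/
def hwn (ξ : K Fq) (n : ℕ) : EReal :=
  sSup ((fun w : ℝ => (w : EReal)) '' hwnSet Fq ξ n)

/-- The defining set for the uniform exponent `ŵ_n^{sep}` (separable polynomials only). -/
def hwnsepSet (ξ : K Fq) (n : ℕ) : Set ℝ :=
  {w | ∃ H0 : ℝ, ∀ H : ℝ, H0 < H → ∃ P : Polynomial (Polynomial Fq),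
      P.Separable ∧ P.natDegree ≤ n ∧ HP Fq P ≤ H ∧ 0 < absK Fq (evalK Fq P ξ) ∧
      absK Fq (evalK Fq P ξ) < H ^ (-w)}

/-- The uniform exponent `ŵ_n^{sep}(ξ)`. -/
def hwnsep (ξ : K Fq) (n : ℕ) : EReal :=
  sSup ((fun w : ℝ => (w : EReal)) '' hwnsepSet Fq ξ n)

/-- The fractional part of a Laurent series in `T⁻¹`: the part with only
 negative powers of `T` (positive powers of the series variable `t = T⁻¹`). -/
def fracPart (η : K Fq) : K Fq :=
  { coeff := fun m => if 0 < m then η.coeff m else 0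
    isPWO_support' := η.isPWO_support'.mono (fun m hm => by
      by_cases h : 0 < m
      · simpa [Function.mem_support, h] using hm
      · simp [Function.mem_support, h] at hm) }

/-- The fractional-part norm `‖η‖ = |η - [η]|`. -/
def fracNorm (η : K Fq) : ℝ := absK Fq (fracPart Fq η)

/-- `max{‖R(T)ξ‖, …, ‖R(T)ξⁿ‖}`. -/
def maxFrac (ξ : K Fq) (n : ℕ) (R : Polynomial Fq) : ℝ :=
  sSup ((fun i => fracNorm Fq (emb Fq R * ξ ^ i)) '' Set.Icc 1 n)

/-- The defining set for the exponent of simultaneous approximation `λ_n`. -/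
def lamSet (ξ : K Fq) (n : ℕ) : Set ℝ :=
  {l | {R : Polynomial Fq | 0 < maxFrac Fq ξ n R ∧
      maxFrac Fq ξ n R < (Fintype.card Fq : ℝ) ^ (-(l * R.natDegree))}.Infinite}

/-- The exponent of simultaneous approximation `λ_n(ξ)`. -/
def lam (ξ : K Fq) (n : ℕ) : EReal :=
  sSup ((fun w : ℝ => (w : EReal)) '' lamSet Fq ξ n)

/-- The defining set for the uniform exponent `λ̂_n`. -/
def hlamSet (ξ : K Fq) (n : ℕ) : Set ℝ :=
  {l | ∃ d0 : ℕ, ∀ d : ℕ, d0 < d → ∃ R : Polynomial Fq, R.natDegree ≤ d ∧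
      0 < maxFrac Fq ξ n R ∧
      maxFrac Fq ξ n R < (Fintype.card Fq : ℝ) ^ (-(l * d))}

/-- The uniform exponent `λ̂_n(ξ)`. -/
def hlam (ξ : K Fq) (n : ℕ) : EReal :=
  sSup ((fun w : ℝ => (w : EReal)) '' hlamSet Fq ξ n)

/-- An algebraic closure of `F_q((T⁻¹))`; its algebraic elements are exactly the
algebraic elements of the completion `C_∞`. -/
abbrev Kbar := AlgebraicClosure (K Fq)

/-- The embedding of `F_q[T]` into the algebraic closure. -/
def embbar : Polynomial Fq →+* Kbar Fq :=
  (algebraMap (K Fq) (Kbar Fq)).comp (emb Fq)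

/-- Evaluation of `P ∈ F_q[T][X]` at a point of the algebraic closure. -/
def evalKbar (P : Polynomial (Polynomial Fq)) (x : Kbar Fq) : Kbar Fq :=
  P.eval₂ (embbar Fq) x

/-- The unique extension of the absolute value of `F_q((T⁻¹))` to its algebraic
closure: `|x| = |N(x)|^{1/d} = |a_0|^{1/d}` where `a_0` is the constant term and
`d` the degree of the minimal polynomial of `x` over `F_q((T⁻¹))`. -/
def absC (x : Kbar Fq) : ℝ :=
  absK Fq ((minpoly (K Fq) x).coeff 0) ^ ((1 : ℝ) / (minpoly (K Fq) x).natDegree)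

/-- `x ∈ C_∞` is algebraic over `F_q[T]`. -/
def IsAlgKbar (x : Kbar Fq) : Prop :=
  ∃ P : Polynomial (Polynomial Fq), P ≠ 0 ∧ evalKbar Fq P x = 0

/-- Degree over `F_q[T]` of an algebraic element of `C_∞`. -/
def degAbar (x : Kbar Fq) : ℕ :=
  sInf {d | ∃ P : Polynomial (Polynomial Fq), P ≠ 0 ∧ P.natDegree = d ∧ evalKbar Fq P x = 0}

/-- Height of an algebraic element of `C_∞`. -/
def HAbar (x : Kbar Fq) : ℝ :=
  sInf {h | ∃ P : Polynomial (Polynomial Fq),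
    P ≠ 0 ∧ P.natDegree = degAbar Fq x ∧ evalKbar Fq P x = 0 ∧ h = HP Fq P}

/-- The defining set for the exponent `w_n^@` (approximation by algebraic
elements of `C_∞`). -/
def wnAtSet (ξ : K Fq) (n : ℕ) : Set ℝ :=
  {w | {α : Kbar Fq | IsAlgKbar Fq α ∧ degAbar Fq α ≤ n ∧
      0 < absC Fq (algebraMap (K Fq) (Kbar Fq) ξ - α) ∧
      absC Fq (algebraMap (K Fq) (Kbar Fq) ξ - α) < HAbar Fq α ^ (-w - 1)}.Infinite}

/-- The exponent `w_n^@(ξ)`. -/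
def wnAt (ξ : K Fq) (n : ℕ) : EReal :=
  sSup ((fun w : ℝ => (w : EReal)) '' wnAtSet Fq ξ n)

/-- The defining set for the uniform exponent `ŵ_n^@`. -/
def hwnAtSet (ξ : K Fq) (n : ℕ) : Set ℝ :=
  {w | ∃ H0 : ℝ, ∀ H : ℝ, H0 < H → ∃ α : Kbar Fq, IsAlgKbar Fq α ∧ degAbar Fq α ≤ n ∧
      HAbar Fq α ≤ H ∧ 0 < absC Fq (algebraMap (K Fq) (Kbar Fq) ξ - α) ∧
      absC Fq (algebraMap (K Fq) (Kbar Fq) ξ - α) < (HAbar Fq α)⁻¹ * H ^ (-w)}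

/-- The uniform exponent `ŵ_n^@(ξ)`. -/
def hwnAt (ξ : K Fq) (n : ℕ) : EReal :=
  sSup ((fun w : ℝ => (w : EReal)) '' hwnAtSet Fq ξ n)

/-- `w(ξ) = limsup_n w_n(ξ)/n`. -/
def wlim (ξ : K Fq) : EReal :=
  Filter.atTop.limsup fun n : ℕ => wn Fq ξ n * (((n : ℝ)⁻¹ : ℝ) : EReal)

/-- `w^*(ξ) = limsup_n w_n^*(ξ)/n`. -/
def wlimstar (ξ : K Fq) : EReal :=
  Filter.atTop.limsup fun n : ℕ => wnstar Fq ξ n * (((n : ℝ)⁻¹ : ℝ) : EReal)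

/-- Height of a polynomial over `C_∞`: maximum of the absolute values of its
coefficients. -/
def HC (P : Polynomial (Kbar Fq)) : ℝ :=
  sSup ((fun i => absC Fq (P.coeff i)) '' Set.Iic P.natDegree)


section helpers

theorem swap_coeff_coeff {R : Type} [CommRing R] (p : Polynomial (Polynomial R)) (i j : ℕ) :
    ((Polynomial.Bivariate.swap p).coeff i).coeff j = (p.coeff j).coeff i := by
  induction p using Polynomial.induction_on' with
  | add p q hp hq => simp [hp, hq]
  | monomial n f =>
    induction f using Polynomial.induction_on' with
    | add p q hp hq => simp only [map_add, coeff_add, hp, hq]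
    | monomial m r =>
      rw [Polynomial.Bivariate.swap_monomial_monomial]
      simp only [coeff_monomial]
      split_ifs <;> simp_all [coeff_monomial]

/-- degree in the coefficient variable -/
theorem swap_natDegree {R : Type} [CommRing R] (p : Polynomial (Polynomial R)) :
    (Polynomial.Bivariate.swap p).natDegree = p.support.sup fun i => (p.coeff i).natDegree := by
  apply le_antisymm
  · rw [natDegree_le_iff_coeff_eq_zero]
    intro N hN
    ext j
    rw [swap_coeff_coeff, coeff_zero]
    by_cases hj : j ∈ p.support
    · apply coeff_eq_zero_of_natDegree_lt
      exact lt_of_le_of_lt (Finset.le_sup (f := fun i => (p.coeff i).natDegree) hj) hN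
    · rw [notMem_support_iff.mp hj, coeff_zero]
  · apply Finset.sup_le
    intro i hi
    rw [natDegree_le_iff_coeff_eq_zero]
    intro N hN
    rw [← swap_coeff_coeff, coeff_eq_zero_of_natDegree_lt hN, coeff_zero]

theorem card_gt_one : (1 : ℝ) < (Fintype.card Fq : ℝ) := by
  exact_mod_cast Fintype.one_lt_card

theorem HP_eq (P : Polynomial (Polynomial Fq)) :
    HP Fq P = (Fintype.card Fq : ℝ) ^ (Polynomial.Bivariate.swap P).natDegree := by
  rw [HP, swap_natDegree]

theorem one_le_HP (P : Polynomial (Polynomial Fq)) : 1 ≤ HP Fq P :=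
  one_le_pow₀ (card_gt_one Fq).le

theorem HP_le_of_dvd {P Q : Polynomial (Polynomial Fq)} (hP : P ≠ 0) (h : Q ∣ P) :
    HP Fq Q ≤ HP Fq P := by
  rw [HP_eq, HP_eq]
  apply pow_le_pow_right₀ (card_gt_one Fq).le
  apply natDegree_le_of_dvd (_root_.map_dvd _ h)
  simpa using hP

theorem HP_le_of_coeff {P : Polynomial (Polynomial Fq)} {D : ℕ}
    (h : ∀ i, (P.coeff i).natDegree ≤ D) : HP Fq P ≤ (Fintype.card Fq : ℝ) ^ D := by
  apply pow_le_pow_right₀ (card_gt_one Fq).le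
  exact Finset.sup_le fun i _ => h i

theorem dvd_of_min {A L : Type} [CommRing A] [IsDomain A] [NormalizedGCDMonoid A] [Field L]
    (φ : A →+* L) (hφ : Function.Injective φ) (α : L) (S P : Polynomial A)
    (hS0 : S ≠ 0) (hprim : S.IsPrimitive) (hSα : S.eval₂ φ α = 0)
    (hmin : ∀ R : Polynomial A, R ≠ 0 → R.eval₂ φ α = 0 → S.natDegree ≤ R.natDegree)
    (hP : P.eval₂ φ α = 0) : S ∣ P := by
  let F := FractionRing A
  let ψ : F →+* L := IsFractionRing.lift hφ
  have hψ : ψ.comp (algebraMap A F) = φ := by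
    ext a; simp [ψ]
  letI : Algebra F L := ψ.toAlgebra
  have key : ∀ R : Polynomial A, R.eval₂ φ α = aeval α (R.map (algebraMap A F)) := by
    intro R
    rw [aeval_def, eval₂_map]
    congr 1
    exact hψ.symm
  have hinj := IsFractionRing.injective A F
  apply hprim.dvd_of_fraction_map_dvd_fraction_map (K := F)
  rw [← EuclideanDomain.mod_eq_zero]
  by_contra hne
  set V := P.map (algebraMap A F) % S.map (algebraMap A F) with hV
  have hVα : aeval α V = 0 := by
    rw [hV, EuclideanDomain.mod_eq_sub_mul_div]
    simp [← key, hSα, hP]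
  have hSne : S.map (algebraMap A F) ≠ 0 := by
    rwa [Ne, Polynomial.map_eq_zero_iff hinj]
  have hdeg : V.degree < (S.map (algebraMap A F)).degree := EuclideanDomain.mod_lt _ hSne
  obtain ⟨b, hb⟩ := IsLocalization.integerNormalization_map_to_map (nonZeroDivisors A) V
  set R := IsLocalization.integerNormalization (nonZeroDivisors A) V with hR
  have hRα : R.eval₂ φ α = 0 := by
    rw [key, hb]
    rw [Algebra.smul_def, map_mul, hVα, mul_zero]
  have hb0 : algebraMap A F b ≠ 0 := by
    intro h
    exact nonZeroDivisors.ne_zero b.2 (hinj (by rw [h, map_zero]))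
  have hbV : (b : A) • V = C (algebraMap A F b) * V := by
    ext i; simp [Algebra.smul_def]
  have hRne : R ≠ 0 := by
    intro h
    have : (b : A) • V = 0 := by rw [← hb, h, Polynomial.map_zero]
    rw [hbV] at this
    simp [hb0, hne] at this
  have h1 := hmin R hRne hRα
  have h2 : R.natDegree = V.natDegree := by
    rw [← natDegree_map_eq_of_injective hinj R, hb, hbV, natDegree_C_mul hb0]
  have h3 : V.natDegree < (S.map (algebraMap A F)).natDegree :=
    natDegree_lt_natDegree hne hdeg
  rw [natDegree_map_eq_of_injective hinj] at h3
  omega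

theorem HA_le (hinj : Function.Injective (emb Fq)) {α : K Fq} {P : Polynomial (Polynomial Fq)}
    (hP : P ≠ 0) (hα : evalK Fq P α = 0) :
    IsAlgK Fq α ∧ degA Fq α ≤ P.natDegree ∧ 1 ≤ HA Fq α ∧ HA Fq α ≤ HP Fq P := by
  have hne : {d | ∃ P : Polynomial (Polynomial Fq), P ≠ 0 ∧ P.natDegree = d ∧
      evalK Fq P α = 0}.Nonempty := ⟨_, P, hP, rfl, hα⟩
  obtain ⟨S, hS0, hSd, hSα⟩ := Nat.sInf_mem hne
  change S.natDegree = degA Fq α at hSd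
  have hmin : ∀ R : Polynomial (Polynomial Fq), R ≠ 0 → evalK Fq R α = 0 →
      degA Fq α ≤ R.natDegree := fun R h1 h2 => Nat.sInf_le ⟨R, h1, rfl, h2⟩
  letI : NormalizedGCDMonoid (Polynomial Fq) := Classical.choice inferInstance
  have hS1 : evalK Fq S.primPart α = 0 := by
    have h := hSα
    rw [S.eq_C_content_mul_primPart, evalK, eval₂_mul, eval₂_C] at h
    rcases mul_eq_zero.mp h with h | h
    · exfalso
      rw [map_eq_zero_iff _ hinj, content_eq_zero_iff] at h
      exact hS0 h
    · exact h
  have hS2 : S.primPart ≠ 0 := S.isPrimitive_primPart.ne_zero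
  have hdvd : S.primPart ∣ P := by
    apply dvd_of_min (emb Fq) hinj α _ _ hS2 S.isPrimitive_primPart hS1 _ hα
    intro R h1 h2
    rw [natDegree_primPart, hSd]
    exact hmin R h1 h2
  refine ⟨⟨P, hP, hα⟩, hmin P hP hα, ?_, ?_⟩
  · unfold HA
    refine le_csInf ⟨HP Fq S, S, hS0, hSd, hSα, rfl⟩ ?_
    rintro _ ⟨Q, -, -, -, rfl⟩
    exact one_le_HP Fq Q
  · refine le_trans (csInf_le ?_ ⟨S.primPart, hS2, ?_, hS1, rfl⟩) (HP_le_of_dvd Fq hP hdvd)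
    · refine ⟨1, ?_⟩
      rintro _ ⟨Q, -, -, -, rfl⟩
      exact one_le_HP Fq Q
    · rw [natDegree_primPart, hSd]

theorem hensel_ps {k : Type} [Field k] (F : Polynomial (PowerSeries k))
    (h0 : (PowerSeries.X : PowerSeries k) ∣ F.coeff 0) (h1 : F.coeff 1 = 1) :
    ∃ x, F.eval x = 0 ∧ F.coeff 0 ∣ x := by
  let I : Ideal (PowerSeries k) := Ideal.span {PowerSeries.X}
  let xs : ℕ → PowerSeries k := fun j => Nat.rec 0 (fun _ x => x - F.eval x) j
  have xs0 : xs 0 = 0 := rfl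
  have xss : ∀ j, xs (j+1) = xs j - F.eval (xs j) := fun j => rfl
  have hF : ∀ x, PowerSeries.X ∣ x → (PowerSeries.X : PowerSeries k) ∣ 1 - F.derivative.eval x := by
    intro x hx
    have h2 := Polynomial.sub_dvd_eval_sub x 0 F.derivative
    rw [sub_zero, ← coeff_zero_eq_eval_zero, coeff_derivative] at h2
    simp [h1] at h2
    rw [← neg_sub]
    exact (hx.trans h2).neg_right
  have claim : ∀ j, PowerSeries.X ∣ xs j ∧
      (PowerSeries.X : PowerSeries k) ^ (j+1) ∣ F.eval (xs j) := by
    intro j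
    induction j with
    | zero =>
      rw [xs0]
      refine ⟨dvd_zero _, ?_⟩
      rw [← coeff_zero_eq_eval_zero]; simpa using h0
    | succ j ih =>
      obtain ⟨ih1, ih2⟩ := ih
      have hX : PowerSeries.X ∣ F.eval (xs j) := (dvd_pow_self _ (Nat.succ_ne_zero j)).trans ih2
      rw [xss]
      refine ⟨dvd_sub ih1 hX, ?_⟩
      obtain ⟨z, hz⟩ := Polynomial.binomExpansion F (xs j) (-F.eval (xs j))
      rw [← sub_eq_add_neg] at hz
      have : F.eval (xs j - F.eval (xs j)) =
          F.eval (xs j) * ((1 - F.derivative.eval (xs j)) + z * F.eval (xs j)) := by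
        rw [hz]; ring
      rw [this, pow_succ]
      exact mul_dvd_mul ih2 (dvd_add (hF _ ih1) (hX.mul_left z))
  have memI : ∀ (m : ℕ) (y : PowerSeries k),
      y ∈ (I ^ m • ⊤ : Submodule (PowerSeries k) (PowerSeries k)) ↔ PowerSeries.X ^ m ∣ y := by
    intro m y
    rw [smul_eq_mul, Ideal.mul_top, Ideal.span_singleton_pow, Ideal.mem_span_singleton]
  have hdiff : ∀ m d, (PowerSeries.X : PowerSeries k) ^ m ∣ xs m - xs (m + d) := by
    intro m d
    induction d with
    | zero => simp
    | succ d ih =>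
      rw [← add_assoc, xss]
      have : xs m - (xs (m+d) - F.eval (xs (m+d))) = (xs m - xs (m+d)) + F.eval (xs (m+d)) := by
        ring
      rw [this]
      exact dvd_add ih ((pow_dvd_pow _ (by omega)).trans (claim (m+d)).2)
  obtain ⟨x, hx⟩ := IsPrecomplete.prec (I := I) (M := PowerSeries k) inferInstance (f := xs) (by
    intro m n hmn
    rw [SModEq.sub_mem, memI]
    obtain ⟨d, rfl⟩ := Nat.exists_eq_add_of_le hmn
    exact hdiff m d)
  have hx' : ∀ j, (PowerSeries.X : PowerSeries k) ^ j ∣ xs j - x := by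
    intro j
    have := hx j
    rwa [SModEq.sub_mem, memI] at this
  have hroot : F.eval x = 0 := by
    ext j
    have h3 : (PowerSeries.X : PowerSeries k) ^ (j+1) ∣ F.eval x := by
      have h4 := (hx' (j+1)).trans (Polynomial.sub_dvd_eval_sub (xs (j+1)) x F)
      have h5 := (pow_dvd_pow (PowerSeries.X : PowerSeries k) (by omega : j+1 ≤ j+1+1)).trans
        (claim (j+1)).2
      have := dvd_sub h5 h4
      simpa using this
    rw [PowerSeries.X_pow_dvd_iff] at h3
    simpa using h3 j (by omega)
  have hxX : (PowerSeries.X : PowerSeries k) ∣ x := by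
    have h4 := hx' 1
    have := dvd_sub (claim 1).1 ((pow_one (PowerSeries.X : PowerSeries k)) ▸ h4)
    simpa using this
  refine ⟨x, hroot, ?_⟩
  have e1 : F.eval x = x * (x * (F.divX.divX).eval x + 1) + F.coeff 0 := by
    conv_lhs => rw [← divX_mul_X_add F, ← divX_mul_X_add F.divX]
    simp [h1]; ring
  obtain ⟨y, hy⟩ := hxX
  have hu : IsUnit (x * (F.divX.divX).eval x + 1) := by
    rw [PowerSeries.isUnit_iff_constantCoeff]
    simp [hy]
  obtain ⟨u, hu⟩ := hu
  rw [hroot, ← hu] at e1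
  refine ⟨-((u⁻¹ : (PowerSeries k)ˣ) : PowerSeries k), ?_⟩
  have : F.coeff 0 = - (x * u) := by linear_combination -e1
  rw [this]
  simp [mul_assoc]

/-- additive valuation -/
abbrev vv : AddValuation (K Fq) (WithTop ℤ) := HahnSeries.addVal ℤ Fq

theorem lift_ps (y : K Fq) (hy : 0 ≤ vv Fq y) : ∃ p : PowerSeries Fq,
    HahnSeries.ofPowerSeries ℤ Fq p = y := by
  refine ⟨PowerSeries.mk fun m => y.coeff m, ?_⟩
  ext m
  rw [PowerSeries.coeff_coe]
  split_ifs with h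
  · symm
    apply HahnSeries.coeff_eq_zero_of_lt_orderTop
    exact lt_of_lt_of_le (by exact_mod_cast h) hy
  · rw [PowerSeries.coeff_mk]
    congr 1
    omega

theorem ps_nonneg (p : PowerSeries Fq) : 0 ≤ vv Fq (HahnSeries.ofPowerSeries ℤ Fq p) := by
  rw [HahnSeries.addVal_apply, HahnSeries.le_orderTop_iff_forall]
  intro j hj
  rw [PowerSeries.coeff_coe, if_pos]
  exact_mod_cast hj

theorem hensel_K (g : Polynomial (K Fq)) (h1 : g.coeff 1 ≠ 0)
    (h0 : vv Fq (g.coeff 1) < vv Fq (g.coeff 0))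
    (h2 : ∀ i, 2 ≤ i → vv Fq (g.coeff 1) ≤ vv Fq (g.coeff i)) :
    ∃ x, g.eval x = 0 ∧ vv Fq (g.coeff 0 / g.coeff 1) ≤ vv Fq x := by
  have hdiv : ∀ y : K Fq, vv Fq (y / g.coeff 1) + vv Fq (g.coeff 1) = vv Fq y := by
    intro y
    rw [← AddValuation.map_mul, div_mul_cancel₀ _ h1]
  have hfin : vv Fq (g.coeff 1) ≠ ⊤ := by simpa using h1
  have hnn : ∀ y, vv Fq (g.coeff 1) ≤ vv Fq y → 0 ≤ vv Fq (y / g.coeff 1) := by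
    intro y hy
    rw [← hdiv y] at hy
    revert hy hfin
    generalize vv Fq (g.coeff 1) = a
    generalize vv Fq (y / g.coeff 1) = b
    intro hfin hy
    by_contra hb
    push Not at hb
    have := WithTop.add_lt_add_right hfin hb
    rw [zero_add] at this
    exact absurd hy (not_le.mpr this)
  have hlift : C (g.coeff 1)⁻¹ * g ∈ Polynomial.lifts (HahnSeries.ofPowerSeries ℤ Fq) := by
    rw [lifts_iff_coeff_lifts]
    intro i
    rw [coeff_C_mul, mul_comm, ← div_eq_mul_inv]
    obtain ⟨p, hp⟩ := lift_ps Fq (g.coeff i / g.coeff 1) (by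
      apply hnn
      match i with
      | 0 => exact h0.le
      | 1 => exact le_rfl
      | i+2 => exact h2 _ (by omega))
    exact ⟨p, hp⟩
  obtain ⟨F, hF⟩ := (mem_lifts _).mp hlift
  have hc : ∀ i, HahnSeries.ofPowerSeries ℤ Fq (F.coeff i) = g.coeff i / g.coeff 1 := by
    intro i
    rw [← coeff_map, hF, coeff_C_mul, mul_comm, ← div_eq_mul_inv]
  obtain ⟨x, hx, hdvd⟩ := hensel_ps F (by
      rw [PowerSeries.X_dvd_iff, ← PowerSeries.coeff_zero_eq_constantCoeff_apply]
      have h3 := hc 0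
      have h4 : (0 : WithTop ℤ) < vv Fq (g.coeff 0 / g.coeff 1) := by
        by_contra hb
        push Not at hb
        have h5 := hdiv (g.coeff 0)
        have h6 : vv Fq (g.coeff 0) ≤ vv Fq (g.coeff 1) := by
          rw [← h5]
          calc _ ≤ 0 + vv Fq (g.coeff 1) := by gcongr
            _ = _ := zero_add _
        exact absurd h0 (not_lt.mpr h6)
      have h7 := HahnSeries.coeff_eq_zero_of_lt_orderTop (i := (0:ℤ)) (by exact_mod_cast h4)
      rw [← h3] at h7
      simpa [PowerSeries.coeff_coe] using h7) (by
      apply HahnSeries.ofPowerSeries_injective (Γ := ℤ)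
      rw [hc 1, div_self h1, map_one])
  refine ⟨HahnSeries.ofPowerSeries ℤ Fq x, ?_, ?_⟩
  · have h3 : (C (g.coeff 1)⁻¹ * g).eval (HahnSeries.ofPowerSeries ℤ Fq x) = 0 := by
      rw [← hF, eval_map, eval₂_hom, hx, map_zero]
    rw [eval_mul, eval_C] at h3
    rcases mul_eq_zero.mp h3 with h | h
    · exact absurd h (inv_ne_zero h1)
    · exact h
  · obtain ⟨y, rfl⟩ := hdvd
    rw [map_mul, hc 0, AddValuation.map_mul]
    exact le_add_of_nonneg_right (ps_nonneg Fq y)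

theorem emb_monomial (k : ℕ) (r : Fq) :
    emb Fq (monomial k r) = HahnSeries.single (-(k : ℤ)) r := by
  rw [emb, coe_eval₂RingHom, eval₂_monomial, Tvar, HahnSeries.single_pow,
    LaurentSeries.algebraMap_apply, HahnSeries.C_apply, HahnSeries.single_mul_single]
  simp

theorem emb_coeff (a : Polynomial Fq) (k : ℕ) : (emb Fq a).coeff (-(k : ℤ)) = a.coeff k := by
  induction a using Polynomial.induction_on' with
  | add p q hp hq => simp [hp, hq]
  | monomial m r =>
    rw [emb_monomial, coeff_monomial]
    by_cases h : m = k
    · subst h; simp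
    · rw [if_neg h, HahnSeries.coeff_single_of_ne]
      omega

theorem emb_coeff_pos (a : Polynomial Fq) (k : ℤ) (hk : 0 < k) : (emb Fq a).coeff k = 0 := by
  induction a using Polynomial.induction_on' with
  | add p q hp hq => simp [hp, hq]
  | monomial m r =>
    rw [emb_monomial, HahnSeries.coeff_single_of_ne]
    omega

theorem emb_inj : Function.Injective (emb Fq) := by
  intro a b h
  ext k
  rw [← emb_coeff, h, emb_coeff]

theorem le_vv_emb (a : Polynomial Fq) (D : ℤ) (h : ∀ k : ℕ, D < k → a.coeff k = 0) :
    ((-D : ℤ) : WithTop ℤ) ≤ vv Fq (emb Fq a) := by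
  rw [HahnSeries.addVal_apply, HahnSeries.le_orderTop_iff_forall]
  intro j hj
  have hj : j < -D := by exact_mod_cast hj
  by_cases h0 : 0 < j
  · exact emb_coeff_pos Fq a j h0
  · obtain ⟨k, hk⟩ := Int.eq_ofNat_of_zero_le (a := -j) (by omega)
    have : j = -(k : ℤ) := by omega
    rw [this, emb_coeff]
    apply h
    omega

theorem vv_emb {a : Polynomial Fq} (ha : a ≠ 0) :
    vv Fq (emb Fq a) = ((-(a.natDegree : ℤ) : ℤ) : WithTop ℤ) := by
  apply le_antisymm
  · apply HahnSeries.addVal_le_of_coeff_ne_zero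
    rw [emb_coeff]
    simpa using ha
  · apply le_vv_emb
    intro k hk
    apply coeff_eq_zero_of_natDegree_lt
    omega

theorem absK_pos {x : K Fq} : 0 < absK Fq x ↔ x ≠ 0 := by
  unfold absK
  have := card_gt_one Fq
  split_ifs with h
  · simp [h]
  · simp only [ne_eq, h, not_false_eq_true, iff_true]
    positivity

theorem absK_lt {x : K Fq} {s : ℤ} (h : (s : WithTop ℤ) < vv Fq x) :
    absK Fq x < (Fintype.card Fq : ℝ) ^ (-s) := by
  unfold absK
  have := card_gt_one Fq
  split_ifs with h0
  · positivity
  · rw [HahnSeries.addVal_apply_of_ne h0] at h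
    have h : s < x.order := by exact_mod_cast h
    exact zpow_lt_zpow_right₀ this (by omega)

theorem evalK_sum {P : Polynomial (Polynomial Fq)} {n : ℕ} (h : P.natDegree ≤ n) (ξ : K Fq) :
    evalK Fq P ξ = ∑ i ∈ Finset.range (n+1), emb Fq (P.coeff i) * ξ ^ i := by
  rw [evalK, eval₂_eq_sum_range' _ (by omega : P.natDegree < n+1)]

theorem emb_smul (r : Fq) (a : Polynomial Fq) : emb Fq (r • a) = r • emb Fq a := by
  rw [smul_eq_C_mul, map_mul]
  have : emb Fq (C r) = HahnSeries.C r := by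
    rw [← monomial_zero_left, emb_monomial]; simp [HahnSeries.C_apply]
  rw [this, HahnSeries.C_mul_eq_smul]

theorem box (ξ : K Fq) (n s M : ℕ) (d : ℕ → ℕ)
    (hM : ∀ i ≤ n, ∀ a : Polynomial Fq, a.degree < d i →
      ((-M : ℤ) : WithTop ℤ) ≤ vv Fq (emb Fq a * ξ ^ i))
    (hcount : s + M + 1 < ∑ i ∈ Finset.range (n+1), d i) :
    ∃ P : Polynomial (Polynomial Fq), P ≠ 0 ∧ P.natDegree ≤ n ∧
      (∀ i ≤ n, (P.coeff i).degree < d i) ∧ ((s : ℤ) : WithTop ℤ) < vv Fq (evalK Fq P ξ) := by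
  let f : ((i : Fin (n+1)) → degreeLT Fq (d i)) →ₗ[Fq] (Fin (s+M+1) → Fq) :=
    { toFun := fun p j => (∑ i : Fin (n+1), emb Fq (p i) * ξ ^ (i : ℕ)).coeff ((j : ℤ) - M)
      map_add' := by
        intro p p'
        ext j
        simp [add_mul, Finset.sum_add_distrib]
      map_smul' := by
        intro r p
        ext j
        have : ∑ i : Fin (n+1), emb Fq ((r • p) i : degreeLT Fq (d i)) * ξ ^ (i : ℕ)
            = r • ∑ i : Fin (n+1), emb Fq (p i) * ξ ^ (i : ℕ) := by
          rw [← HahnSeries.C_mul_eq_smul, Finset.mul_sum]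
          apply Finset.sum_congr rfl
          intro i _
          rw [Pi.smul_apply, Submodule.coe_smul, emb_smul, ← HahnSeries.C_mul_eq_smul,
            mul_assoc]
        rw [this]
        simp }
  have hfr : ∀ m : ℕ, Module.finrank Fq (degreeLT Fq m) = m := by
    intro m
    rw [(degreeLTEquiv Fq m).finrank_eq]; simp
  have hfd : ∀ m : ℕ, FiniteDimensional Fq (degreeLT Fq m) := fun m =>
    (degreeLTEquiv Fq m).symm.finiteDimensional
  have hker : LinearMap.ker f ≠ ⊥ := by
    apply LinearMap.ker_ne_bot_of_finrank_lt
    rw [Module.finrank_fin_fun, Module.finrank_pi_fintype]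
    simp only [hfr]
    rw [Fin.sum_univ_eq_sum_range]
    exact hcount
  obtain ⟨p, hp, hp0⟩ := Submodule.exists_mem_ne_zero_of_ne_bot hker
  rw [LinearMap.mem_ker] at hp
  let P : Polynomial (Polynomial Fq) := ∑ i : Fin (n+1), monomial (i : ℕ) (p i : Polynomial Fq)
  have hPc : ∀ i : Fin (n+1), P.coeff i = p i := by
    intro i
    simp only [P, finsetSum_coeff, coeff_monomial]
    rw [Finset.sum_eq_single i]
    · simp
    · intro b _ hb
      rw [if_neg]
      exact fun h => hb (Fin.ext h)
    · simp
  have hdeg : P.natDegree ≤ n := by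
    apply natDegree_sum_le_of_forall_le
    intro i _
    exact (natDegree_monomial_le _).trans (by omega)
  have hlt : ∀ i ≤ n, (P.coeff i).degree < d i := by
    have h1 : ∀ i : Fin (n+1), (P.coeff i).degree < d i := fun i => by
      rw [hPc i]; exact mem_degreeLT.mp (p i).2
    intro i hi
    exact h1 ⟨i, by omega⟩
  refine ⟨P, ?_, hdeg, hlt, ?_⟩
  · intro h
    apply hp0
    ext1 i
    apply Subtype.ext
    have := hPc i
    rw [h, coeff_zero] at this
    exact this.symm
  · have hge : ((-M : ℤ) : WithTop ℤ) ≤ vv Fq (evalK Fq P ξ) := by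
      rw [evalK_sum Fq hdeg]
      apply AddValuation.map_le_sum
      intro i hi
      have hi : i ≤ n := by simpa [Nat.lt_succ_iff] using hi
      exact hM i hi _ (hlt i hi)
    have hs : (((s : ℤ) + 1 : ℤ) : WithTop ℤ) ≤ vv Fq (evalK Fq P ξ) := by
      rw [HahnSeries.addVal_apply, HahnSeries.le_orderTop_iff_forall]
      intro j hj
      have hj : j < (s : ℤ) + 1 := by exact_mod_cast hj
      by_cases h : j < -M
      · apply HahnSeries.coeff_eq_zero_of_lt_orderTop
        exact lt_of_lt_of_le (by exact_mod_cast h) hge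
      · obtain ⟨k, hk⟩ := Int.eq_ofNat_of_zero_le (a := j + M) (by omega)
        have hk' : k < s + M + 1 := by omega
        have h2 := congrFun hp ⟨k, hk'⟩
        have hjk : j = (k : ℤ) - M := by omega
        rw [evalK_sum Fq hdeg, Finset.sum_range, hjk]
        simp only [hPc]
        exact h2
    refine lt_of_lt_of_le ?_ hs
    exact_mod_cast (by omega : (s : ℤ) < s + 1)

theorem vv_natCast (m : ℕ) : 0 ≤ vv Fq (m : K Fq) := by
  rw [← map_natCast (HahnSeries.ofPowerSeries ℤ Fq)]
  exact ps_nonneg Fq _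

theorem core (ξ : K Fq) (n c s : ℕ) (hc : ∀ i ≤ n, ((-c : ℤ) : WithTop ℤ) ≤ vv Fq (ξ ^ i))
    (P : Polynomial (Polynomial Fq)) (hdeg : P.natDegree ≤ n) (h1 : P.coeff 1 ≠ 0)
    (hs : ((s : ℤ) : WithTop ℤ) < vv Fq (evalK Fq P ξ))
    (hbig : ∀ i, 2 ≤ i →
      ((c - (P.coeff 1).natDegree : ℤ) : WithTop ℤ) < vv Fq (emb Fq (P.coeff i))) :
    ∃ α, evalK Fq P α = 0 ∧
      ((s + (P.coeff 1).natDegree : ℤ) : WithTop ℤ) < vv Fq (ξ - α) := by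
  have hn1 : 1 ≤ n := (le_natDegree_of_ne_zero h1).trans hdeg
  set e : ℤ := ((P.coeff 1).natDegree : ℤ) with he
  set f := P.map (emb Fq) with hf
  have hfe : ∀ x, f.eval x = evalK Fq P x := fun x => by rw [hf, eval_map, evalK]
  set g := taylor ξ f with hg
  let t : ℕ → ℕ → K Fq := fun k i => emb Fq (P.coeff i) * (ξ ^ (i - k) * (i.choose k : ℕ))
  have hgc : ∀ k, g.coeff k = ∑ i ∈ Finset.range (n+1), t k i := by
    intro k
    have hfs : f = ∑ i ∈ Finset.range (n+1), monomial i (emb Fq (P.coeff i)) := by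
      conv_lhs => rw [as_sum_range' f (n+1) (by
        exact lt_of_le_of_lt natDegree_map_le (by omega))]
      simp [hf]
    rw [hg, hfs, map_sum, finsetSum_coeff]
    apply Finset.sum_congr rfl
    intro i _
    rw [taylor_monomial, coeff_C_mul, coeff_X_add_C_pow]
  have hti : ∀ k i, 2 ≤ i → i ≤ n → ((-e : ℤ) : WithTop ℤ) < vv Fq (t k i) := by
    intro k i hi hin
    have h3 := hbig i hi
    have h4 := hc (i-k) (by omega)
    have h5 := vv_natCast Fq (i.choose k)
    simp only [t, AddValuation.map_mul]
    revert h3 h4 h5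
    generalize vv Fq (emb Fq (P.coeff i)) = A
    generalize vv Fq (ξ ^ (i-k)) = B
    generalize vv Fq ((i.choose k : ℕ) : K Fq) = D
    intro h3 h4 h5
    have h6 : ((c - e : ℤ) : WithTop ℤ) + (((-c : ℤ) : WithTop ℤ) + 0) < A + (B + D) :=
      WithTop.add_lt_add_of_lt_of_le (by simp) h3 (add_le_add h4 h5)
    refine lt_of_eq_of_lt ?_ h6
    rw [add_zero, ← WithTop.coe_add]
    congr 1
    ring
  have hg1 : vv Fq (g.coeff 1) = ((-e : ℤ) : WithTop ℤ) := by
    rw [hgc, ← Finset.add_sum_erase _ _ (Finset.mem_range.mpr (by omega : 1 < n+1))]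
    have ht : t 1 1 = emb Fq (P.coeff 1) := by simp [t]
    have h3 : ((-e : ℤ) : WithTop ℤ) <
        vv Fq (∑ i ∈ (Finset.range (n+1)).erase 1, t 1 i) := by
      refine AddValuation.map_lt_sum (vv Fq) WithTop.coe_ne_top ?_
      intro i hi
      rw [Finset.mem_erase, Finset.mem_range] at hi
      by_cases h : i = 0
      · subst h
        have : t 1 0 = 0 := by simp [t]
        rw [this, AddValuation.map_zero]
        exact WithTop.coe_lt_top _
      · exact hti 1 i (by omega) (by omega)
    have h4 : vv Fq (t 1 1) = ((-e : ℤ) : WithTop ℤ) := by rw [ht, vv_emb Fq h1]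
    rw [← h4] at h3 ⊢
    exact AddValuation.map_add_eq_of_lt_left _ h3
  have hgk : ∀ k, 2 ≤ k → ((-e : ℤ) : WithTop ℤ) < vv Fq (g.coeff k) := by
    intro k hk
    rw [hgc]
    refine AddValuation.map_lt_sum (vv Fq) WithTop.coe_ne_top ?_
    intro i hi
    rw [Finset.mem_range] at hi
    by_cases h : i < 2
    · have : t k i = 0 := by simp [t, Nat.choose_eq_zero_of_lt (by omega : i < k)]
      rw [this, AddValuation.map_zero]
      exact WithTop.coe_lt_top _
    · exact hti k i (by omega) (by omega)
  have hg0 : g.coeff 0 = evalK Fq P ξ := by rw [hg, taylor_coeff_zero, hfe]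
  have hg1ne : g.coeff 1 ≠ 0 := by
    intro h
    rw [h, AddValuation.map_zero] at hg1
    exact absurd hg1.symm WithTop.coe_ne_top
  obtain ⟨x, hx, hvx⟩ := hensel_K Fq g hg1ne (by
      rw [hg0, hg1]
      refine lt_of_le_of_lt ?_ hs
      exact_mod_cast (by omega : -e ≤ (s : ℤ))) (by
      intro i hi
      rw [hg1]; exact (hgk i hi).le)
  refine ⟨x + ξ, ?_, ?_⟩
  · rw [← hfe, ← taylor_eval, ← hg, hx]
  · have h3 : ξ - (x + ξ) = -x := by ring
    rw [h3, AddValuation.map_neg]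
    refine lt_of_lt_of_le ?_ hvx
    have h4 : vv Fq (g.coeff 0 / g.coeff 1) + vv Fq (g.coeff 1) = vv Fq (g.coeff 0) := by
      rw [← AddValuation.map_mul, div_mul_cancel₀ _ hg1ne]
    rw [hg1] at h4
    rw [← hg0, ← h4] at hs
    revert hs
    generalize vv Fq (g.coeff 0 / g.coeff 1) = A
    intro hs
    induction A using WithTop.recTopCoe with
    | top => exact WithTop.coe_lt_top _
    | coe A =>
      rw [← WithTop.coe_add] at hs
      have hs : (s : ℤ) < A + -e := by exact_mod_cast hs
      exact_mod_cast (by omega : (s : ℤ) + e < A)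

theorem mem_wnstar (ξ : K Fq) (n c : ℕ) (hnotalg : ¬ IsAlgDegLe Fq ξ n)
    (hc : ∀ i ≤ n, ((-c : ℤ) : WithTop ℤ) ≤ vv Fq (ξ ^ i)) (w : ℝ) (hw : 0 < w)
    (H : ∀ N : ℕ, ∃ s ≥ N, ∃ P : Polynomial (Polynomial Fq), P.natDegree ≤ n ∧ P.coeff 1 ≠ 0 ∧
      ((s : ℤ) : WithTop ℤ) < vv Fq (evalK Fq P ξ) ∧
      (∀ i, 2 ≤ i →
        ((c - (P.coeff 1).natDegree : ℤ) : WithTop ℤ) < vv Fq (emb Fq (P.coeff i))) ∧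
      (∀ i, (P.coeff i).natDegree ≤ (P.coeff 1).natDegree + c) ∧
      (((P.coeff 1).natDegree : ℝ) + c) * w + c ≤ s) :
    w ∈ wnstarSet Fq ξ n := by
  have hq := card_gt_one Fq
  have hq0 : (0 : ℝ) < Fintype.card Fq := by linarith
  have key : ∀ N : ℕ, ∃ α : K Fq, (IsAlgK Fq α ∧ degA Fq α ≤ n ∧ 0 < absK Fq (ξ - α) ∧
      absK Fq (ξ - α) < HA Fq α ^ (-w - 1)) ∧ ξ - α ≠ 0 ∧
      ((N : ℤ) : WithTop ℤ) < vv Fq (ξ - α) := by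
    intro N
    obtain ⟨s, hsN, P, hdeg, h1, hs, hbig, hall, hw'⟩ := H N
    obtain ⟨α, hα, hv⟩ := core Fq ξ n c s hc P hdeg h1 hs hbig
    have hP0 : P ≠ 0 := by rintro rfl; simp at h1
    have hne : ξ - α ≠ 0 := by
      intro h
      rw [sub_eq_zero] at h
      subst h
      exact hnotalg ⟨P, hP0, hdeg, hα⟩
    obtain ⟨g1, g2, g3, g4⟩ := HA_le Fq (emb_inj Fq) hP0 hα
    refine ⟨α, ⟨g1, g2.trans hdeg, (absK_pos Fq).mpr hne, ?_⟩, hne, ?_⟩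
    · refine lt_of_lt_of_le (absK_lt Fq hv) ?_
      have g5 : HA Fq α ≤ (Fintype.card Fq : ℝ) ^ ((P.coeff 1).natDegree + c) :=
        g4.trans (HP_le_of_coeff Fq hall)
      have g6 := Real.rpow_le_rpow_of_nonpos (by linarith) g5 (by linarith : -w - 1 ≤ 0)
      refine le_trans ?_ g6
      rw [← Real.rpow_natCast, ← Real.rpow_mul hq0.le, ← Real.rpow_intCast]
      apply Real.rpow_le_rpow_of_exponent_le hq.le
      push_cast
      nlinarith
    · refine lt_of_le_of_lt ?_ hv
      exact_mod_cast (by omega : (N : ℤ) ≤ s + (P.coeff 1).natDegree)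
  intro hfin
  obtain ⟨B, hB⟩ := (hfin.image fun α => (ξ - α).order.toNat).bddAbove
  obtain ⟨α, hα, hne, hv⟩ := key B
  have h1 := hB ⟨α, hα, rfl⟩
  rw [HahnSeries.addVal_apply_of_ne hne] at hv
  have hv : (B : ℤ) < (ξ - α).order := by exact_mod_cast hv
  simp only at h1
  omega

theorem exists_c (ξ : K Fq) (n : ℕ) :
    ∃ c : ℕ, ∀ i ≤ n, ((-c : ℤ) : WithTop ℤ) ≤ vv Fq (ξ ^ i) := by
  refine ⟨∑ i ∈ Finset.range (n+1), (-(ξ ^ i).order).toNat, ?_⟩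
  intro i hi
  by_cases h : ξ ^ i = 0
  · rw [h, AddValuation.map_zero]; exact le_top
  · rw [HahnSeries.addVal_apply_of_ne h]
    have h1 := Finset.single_le_sum (f := fun i => (-(ξ ^ i).order).toNat)
      (fun _ _ => Nat.zero_le _) (Finset.mem_range.mpr (by omega : i < n+1))
    norm_cast
    omega

theorem natDegree_lt_of_degree_lt' {a : Polynomial Fq} {h : ℕ} (H : a.degree < (h + 1 : ℕ)) :
    a.natDegree ≤ h := by
  by_cases ha : a = 0
  · simp [ha]
  · have := (natDegree_lt_iff_degree_lt ha).mpr H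
    omega

theorem boxed (ξ : K Fq) (n c s t k : ℕ) (hn : 1 ≤ n)
    (hc : ∀ i ≤ n, ((-c : ℤ) : WithTop ℤ) ≤ vv Fq (ξ ^ i))
    (hk : k ≤ t + 1) (hcount : s < t + 1 + (n - 1) * k) :
    ∃ P : Polynomial (Polynomial Fq), P ≠ 0 ∧ P.natDegree ≤ n ∧
      (∀ i, 2 ≤ i → (P.coeff i).degree < k) ∧ (P.coeff 1).natDegree ≤ t ∧
      ((s : ℤ) : WithTop ℤ) < vv Fq (evalK Fq P ξ) := by
  let d : ℕ → ℕ := fun i => if i = 0 then t + c + 1 else if i = 1 then t + 1 else k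
  obtain ⟨P, h1, h2, h3, h4⟩ := box Fq ξ n s (t + c) d (by
      intro i hi a ha
      have hz : ∀ D : ℕ, a.degree < (D + 1 : ℕ) → ((-(D : ℤ) : ℤ) : WithTop ℤ) ≤ vv Fq (emb Fq a) := by
        intro D hD
        apply le_vv_emb
        intro j hj
        apply coeff_eq_zero_of_degree_lt
        refine lt_of_lt_of_le hD ?_
        exact_mod_cast (by omega : D + 1 ≤ j)
      by_cases h0 : i = 0
      · subst h0
        have := hz (t + c) (by simpa [d] using ha)
        simpa using this
      · have h5 : ((-(t : ℤ) : ℤ) : WithTop ℤ) ≤ vv Fq (emb Fq a) := by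
          apply hz
          refine lt_of_lt_of_le ha ?_
          have : d i ≤ t + 1 := by
            simp only [d, if_neg h0]
            split_ifs <;> omega
          exact_mod_cast this
        rw [AddValuation.map_mul]
        refine le_trans (le_of_eq ?_) (add_le_add h5 (hc i hi))
        rw [← WithTop.coe_add]
        congr 1
        push_cast; ring) (by
      obtain ⟨m, rfl⟩ : ∃ m, n = m + 1 := ⟨n - 1, by omega⟩
      rw [Finset.sum_range_succ', Finset.sum_range_succ']
      simp [d]
      simp at hcount
      omega)
  refine ⟨P, h1, h2, ?_, ?_, h4⟩
  · intro i hi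
    by_cases hin : i ≤ n
    · have := h3 i hin
      simp only [d] at this
      rwa [if_neg (by omega), if_neg (by omega)] at this
    · rw [coeff_eq_zero_of_natDegree_lt (by omega), degree_zero]
      exact WithBot.bot_lt_coe _
  · have : (P.coeff 1).degree < ((t + 1 : ℕ) : WithBot ℕ) := by
      have h6 : d 1 = t + 1 := by simp [d]
      have := h3 1 hn
      rwa [h6] at this
    exact natDegree_lt_of_degree_lt' Fq this

theorem a0bound (ξ : K Fq) (n c : ℕ)
    (hc : ∀ i ≤ n, ((-c : ℤ) : WithTop ℤ) ≤ vv Fq (ξ ^ i))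
    (P : Polynomial (Polynomial Fq)) (hdeg : P.natDegree ≤ n)
    (hs : 0 ≤ vv Fq (evalK Fq P ξ)) (B : ℕ)
    (hB : ∀ i, 1 ≤ i → (P.coeff i).natDegree ≤ B) :
    (P.coeff 0).natDegree ≤ B + c := by
  by_cases h0 : P.coeff 0 = 0
  · simp [h0]
  have h1 := evalK_sum Fq hdeg ξ
  rw [Finset.sum_range_succ'] at h1
  have h2 : emb Fq (P.coeff 0) = evalK Fq P ξ -
      ∑ i ∈ Finset.range n, emb Fq (P.coeff (i+1)) * ξ ^ (i+1) := by
    rw [h1]; simp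
  have h3 : ((-(B + c : ℤ) : ℤ) : WithTop ℤ) ≤ vv Fq (emb Fq (P.coeff 0)) := by
    rw [h2]
    apply AddValuation.map_le_sub
    · refine le_trans ?_ hs
      exact_mod_cast (by omega : -(B + c : ℤ) ≤ 0)
    · apply AddValuation.map_le_sum
      intro i hi
      rw [Finset.mem_range] at hi
      rw [AddValuation.map_mul]
      have h4 : ((-(B : ℤ) : ℤ) : WithTop ℤ) ≤ vv Fq (emb Fq (P.coeff (i+1))) := by
        apply le_vv_emb
        intro k hk
        apply coeff_eq_zero_of_natDegree_lt
        have := hB (i+1) (by omega)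
        omega
      refine le_trans (le_of_eq ?_) (add_le_add h4 (hc (i+1) (by omega)))
      rw [← WithTop.coe_add]
      congr 1
      ring
  rw [vv_emb Fq h0] at h3
  have h3 : -(B + c : ℤ) ≤ -((P.coeff 0).natDegree : ℤ) := by exact_mod_cast h3
  omega

theorem mem_wnstar_one (ξ : K Fq) (n : ℕ) (hn : 1 ≤ n) (hnotalg : ¬ IsAlgDegLe Fq ξ n)
    (w : ℝ) (hw : 0 < w) (hw1 : w < 1) : w ∈ wnstarSet Fq ξ n := by
  obtain ⟨c, hc⟩ := exists_c Fq ξ n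
  apply mem_wnstar Fq ξ n c hnotalg hc w hw
  intro N
  obtain ⟨s0, hs0⟩ := exists_nat_ge ((c * w + c) / (1 - w))
  refine ⟨max N s0, le_max_left _ _, ?_⟩
  set s := max N s0
  obtain ⟨P, h1, h2, h3, h4, h5⟩ := boxed Fq ξ n c s s 0 hn hc (by omega) (by simp)
  have h0s : (0 : WithTop ℤ) ≤ ((s : ℤ) : WithTop ℤ) := by
    exact_mod_cast (by omega : (0 : ℤ) ≤ s)
  have h3' : ∀ i, 2 ≤ i → P.coeff i = 0 := by
    intro i hi
    have := h3 i hi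
    simpa [degree_lt_iff_coeff_zero, Polynomial.ext_iff] using this
  have ha1 : P.coeff 1 ≠ 0 := by
    intro h
    have hPC : P = C (P.coeff 0) := by
      ext1 i
      rw [coeff_C]
      split_ifs with hi
      · rw [hi]
      · by_cases hi1 : i = 1
        · rw [hi1, h]
        · exact h3' i (by omega)
    have hne : P.coeff 0 ≠ 0 := by
      intro h'
      rw [h', C_0] at hPC
      exact h1 hPC
    have h6 : evalK Fq P ξ = emb Fq (P.coeff 0) := by
      conv_lhs => rw [hPC]
      rw [evalK, eval₂_C]
    rw [h6, vv_emb Fq hne] at h5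
    have h5 : (s : ℤ) < -((P.coeff 0).natDegree : ℤ) := by exact_mod_cast h5
    omega
  refine ⟨P, h2, ha1, h5, ?_, ?_, ?_⟩
  · intro i hi
    rw [h3' i hi, map_zero, AddValuation.map_zero]
    exact WithTop.coe_lt_top _
  · have hB : ∀ i, 1 ≤ i → (P.coeff i).natDegree ≤ (P.coeff 1).natDegree := by
      intro i hi
      by_cases hi1 : i = 1
      · rw [hi1]
      · rw [h3' i (by omega)]; simp
    intro i
    by_cases hi : i = 0
    · rw [hi]
      exact a0bound Fq ξ n c hc P h2 (h0s.trans h5.le) _ hB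
    · exact (hB i (by omega)).trans (by omega)
  · have h6 : ((P.coeff 1).natDegree : ℝ) ≤ s := by exact_mod_cast h4
    have h7 : (s0 : ℝ) ≤ s := by exact_mod_cast le_max_right _ _
    have h8 : (c * w + c) / (1 - w) ≤ s := hs0.trans h7
    rw [div_le_iff₀ (by linarith)] at h8
    nlinarith

theorem mem_hwn (ξ : K Fq) (n : ℕ) (hn : 1 ≤ n) (hnotalg : ¬ IsAlgDegLe Fq ξ n)
    (w : ℝ) (hw : w < n) : w ∈ hwnSet Fq ξ n := by
  obtain ⟨c, hc⟩ := exists_c Fq ξ n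
  have hq := card_gt_one Fq
  have hq0 : (0 : ℝ) < Fintype.card Fq := by linarith
  set q : ℝ := (Fintype.card Fq : ℝ) with hqdef
  set X : ℝ := max (c + 1) ((n * c + 1) / (n - w)) with hX
  refine ⟨q ^ X, ?_⟩
  intro H hH
  have hH0 : 0 < H := lt_trans (Real.rpow_pos_of_pos hq0 _) hH
  set L := Real.logb q H with hL
  have hHL : q ^ L = H := Real.rpow_logb hq0 (by linarith) hH0
  have hXL : X < L := by
    rw [← hHL] at hH
    exact (Real.rpow_lt_rpow_left_iff hq).mp hH
  have hL1 : (c : ℝ) + 1 < L := lt_of_le_of_lt (le_max_left _ _) hXL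
  have hL2 : (n * c + 1) / (n - w) < L := lt_of_le_of_lt (le_max_right _ _) hXL
  have hc0 : (0 : ℝ) ≤ c := Nat.cast_nonneg _
  set h0 := ⌊L⌋₊ with hh0
  have hf1 : (h0 : ℝ) ≤ L := Nat.floor_le (by linarith)
  have hf2 : L < h0 + 1 := Nat.lt_floor_add_one L
  have hch : c < h0 := by
    have : (c : ℝ) < h0 := by linarith
    exact_mod_cast this
  obtain ⟨h, hh⟩ : ∃ h, h0 = h + c := ⟨h0 - c, by omega⟩
  have hpos : 1 ≤ n * (h + 1) := Nat.mul_pos (by omega) (by omega)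
  obtain ⟨s, hs⟩ : ∃ s, s + 1 = n * (h + 1) := ⟨n * (h+1) - 1, by omega⟩
  obtain ⟨P, h1, h2, h3, h4, h5⟩ := boxed Fq ξ n c s h (h+1) hn hc le_rfl (by
    obtain ⟨m, rfl⟩ : ∃ m, n = m + 1 := ⟨n - 1, by omega⟩
    simp
    linarith)
  have h0s : (0 : WithTop ℤ) ≤ ((s : ℤ) : WithTop ℤ) := by
    exact_mod_cast (by omega : (0 : ℤ) ≤ s)
  have hB : ∀ i, 1 ≤ i → (P.coeff i).natDegree ≤ h := by
    intro i hi
    by_cases hi1 : i = 1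
    · rw [hi1]; exact h4
    · exact natDegree_lt_of_degree_lt' Fq (h3 i (by omega))
  refine ⟨P, h2, ?_, ?_, ?_⟩
  · refine (HP_le_of_coeff Fq (D := h0) ?_).trans ?_
    · intro i
      rw [hh]
      by_cases hi : i = 0
      · rw [hi]
        exact a0bound Fq ξ n c hc P h2 (h0s.trans h5.le) _ hB
      · exact (hB i (by omega)).trans (by omega)
    · rw [← hHL, ← Real.rpow_natCast]
      exact Real.rpow_le_rpow_of_exponent_le hq.le hf1
  · rw [absK_pos]
    intro h
    exact hnotalg ⟨P, h1, h2, h⟩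
  · refine lt_of_lt_of_le (absK_lt Fq h5) ?_
    rw [← hHL, ← Real.rpow_mul hq0.le, ← Real.rpow_intCast]
    apply Real.rpow_le_rpow_of_exponent_le hq.le
    rw [div_lt_iff₀ (by linarith)] at hL2
    have e1 : (s : ℝ) + 1 = n * (h + 1) := by exact_mod_cast hs
    have e2 : (h0 : ℝ) = h + c := by exact_mod_cast hh
    have e3 : (n : ℝ) * L ≤ n * (h + c + 1) :=
      mul_le_mul_of_nonneg_left (by linarith) (Nat.cast_nonneg _)
    push_cast
    nlinarith

theorem mem_wnstar_main (ξ : K Fq) (n : ℕ) (hn : 1 ≤ n) (hnotalg : ¬ IsAlgDegLe Fq ξ n)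
    (w w' : ℝ) (hw : w ∉ hwnSet Fq ξ n) (hwn : n ≤ w) (hw' : 0 < w')
    (hww : w' * (w - n + 1) < w) : w' ∈ wnstarSet Fq ξ n := by
  obtain ⟨c, hc⟩ := exists_c Fq ξ n
  have hq := card_gt_one Fq
  have hq0 : (0 : ℝ) < Fintype.card Fq := by linarith
  set q : ℝ := (Fintype.card Fq : ℝ) with hqdef
  apply mem_wnstar Fq ξ n c hnotalg hc w' hw'
  intro N
  set X : ℝ := max (max N (2 * c + 3))
    ((w' * (1 + (n - 1) * (2 * c + 1) + c) + c) / (w - w' * (w - n + 1))) with hX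
  have hw2 : ∃ H, q ^ X < H ∧ ∀ P : Polynomial (Polynomial Fq),
      P.natDegree ≤ n → 0 < absK Fq (evalK Fq P ξ) →
      absK Fq (evalK Fq P ξ) < H ^ (-w) → H < HP Fq P := by
    by_contra hcon
    push Not at hcon
    apply hw
    refine ⟨q ^ X, fun H hH => ?_⟩
    obtain ⟨P, g1, g2, g3, g4⟩ := hcon H hH
    exact ⟨P, g1, g4, g2, g3⟩
  obtain ⟨H, hH, hPH⟩ := hw2
  have hH0 : 0 < H := lt_trans (Real.rpow_pos_of_pos hq0 _) hH
  set L := Real.logb q H with hL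
  have hHL : q ^ L = H := Real.rpow_logb hq0 (by linarith) hH0
  have hXL : X < L := by
    rw [← hHL] at hH
    exact (Real.rpow_lt_rpow_left_iff hq).mp hH
  have hL0 : (N : ℝ) < L := lt_of_le_of_lt ((le_max_left _ _).trans (le_max_left _ _)) hXL
  have hL1 : (2 * c + 3 : ℝ) < L :=
    lt_of_le_of_lt ((le_max_right _ _).trans (le_max_left _ _)) hXL
  have hL2 := lt_of_le_of_lt (le_max_right _ _) hXL
  rw [div_lt_iff₀ (by linarith)] at hL2
  have hc0 : (0 : ℝ) ≤ c := Nat.cast_nonneg _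
  have hn1 : (1 : ℝ) ≤ n := by exact_mod_cast hn
  set h0 := ⌊L⌋₊ with hh0
  have hf1 : (h0 : ℝ) ≤ L := Nat.floor_le (by linarith)
  have hf2 : L < h0 + 1 := Nat.lt_floor_add_one L
  have hch : 2 * c + 2 < h0 := by
    have : (2 * c + 2 : ℝ) < h0 := by linarith
    exact_mod_cast this
  obtain ⟨h, hh⟩ : ∃ h, h0 = h + (2 * c + 1) := ⟨h0 - (2 * c + 1), by omega⟩
  set s := ⌈w * L⌉₊ with hs
  have hs1 : w * L ≤ s := Nat.le_ceil _
  have hs2 : (s : ℝ) < w * L + 1 := Nat.ceil_lt_add_one (by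
    apply mul_nonneg <;> linarith)
  have hsn : n * h0 ≤ s := by
    have : (n : ℝ) * h0 ≤ s :=
      (mul_le_mul hwn hf1 (Nat.cast_nonneg _) (by linarith)).trans hs1
    exact_mod_cast this
  obtain ⟨m, hm⟩ : ∃ m, n = m + 1 := ⟨n - 1, by omega⟩
  have hmh : m * (h + 1) + h0 ≤ s := by
    have : m * (h + 1) ≤ m * h0 := Nat.mul_le_mul_left _ (by omega)
    rw [hm] at hsn
    linarith
  obtain ⟨t, ht⟩ : ∃ t, s = m * (h + 1) + t := ⟨s - m * (h+1), by omega⟩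
  obtain ⟨P, h1, h2, h3, h4, h5⟩ := boxed Fq ξ n c s t (h+1) hn hc (by omega) (by
    rw [hm, Nat.add_sub_cancel]; omega)
  have h0s : (0 : WithTop ℤ) ≤ ((s : ℤ) : WithTop ℤ) := by
    exact_mod_cast (by omega : (0 : ℤ) ≤ s)
  have hB2 : ∀ i, 2 ≤ i → (P.coeff i).natDegree ≤ h := fun i hi =>
    natDegree_lt_of_degree_lt' Fq (h3 i hi)
  have ha0 := a0bound Fq ξ n c hc P h2 (h0s.trans h5.le)
  have hne : evalK Fq P ξ ≠ 0 := fun h => hnotalg ⟨P, h1, h2, h⟩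
  have hbigH : H < HP Fq P := by
    apply hPH P h2 ((absK_pos Fq).mpr hne)
    refine lt_of_lt_of_le (absK_lt Fq h5) ?_
    rw [← hHL, ← Real.rpow_mul hq0.le, ← Real.rpow_intCast]
    apply Real.rpow_le_rpow_of_exponent_le hq.le
    push_cast
    linarith
  have he : h + c < (P.coeff 1).natDegree := by
    by_contra hcon
    push Not at hcon
    have hB : ∀ i, 1 ≤ i → (P.coeff i).natDegree ≤ h + c := by
      intro i hi
      by_cases hi1 : i = 1
      · rw [hi1]; exact hcon
      · exact (hB2 i (by omega)).trans (by omega)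
    have hle : HP Fq P ≤ q ^ h0 := by
      apply HP_le_of_coeff Fq
      intro i
      by_cases hi : i = 0
      · rw [hi]
        exact (ha0 _ hB).trans (by omega)
      · exact (hB i (by omega)).trans (by omega)
    have hle2 : q ^ h0 ≤ H := by
      rw [← hHL, ← Real.rpow_natCast]
      exact Real.rpow_le_rpow_of_exponent_le hq.le hf1
    linarith
  refine ⟨s, ?_, P, h2, ?_, h5, ?_, ?_, ?_⟩
  · have : (N : ℝ) ≤ s := by nlinarith
    exact_mod_cast this
  · intro h
    rw [h, natDegree_zero] at he
    omega
  · intro i hi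
    have h6 : ((-(h : ℤ) : ℤ) : WithTop ℤ) ≤ vv Fq (emb Fq (P.coeff i)) := by
      apply le_vv_emb
      intro k hk
      apply coeff_eq_zero_of_natDegree_lt
      have := hB2 i hi
      omega
    refine lt_of_lt_of_le ?_ h6
    exact_mod_cast (by omega : (c : ℤ) - (P.coeff 1).natDegree < -h)
  · have hB : ∀ i, 1 ≤ i → (P.coeff i).natDegree ≤ (P.coeff 1).natDegree := by
      intro i hi
      by_cases hi1 : i = 1
      · rw [hi1]
      · exact (hB2 i (by omega)).trans (by omega)
    intro i
    by_cases hi : i = 0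
    · rw [hi]
      exact ha0 _ hB
    · exact (hB i (by omega)).trans (by omega)
  · have e1 : ((P.coeff 1).natDegree : ℝ) ≤ t := by exact_mod_cast h4
    have e2 : (s : ℝ) = m * (h + 1) + t := by exact_mod_cast ht
    have e3 : (n : ℝ) = m + 1 := by exact_mod_cast hm
    have e4 : (h0 : ℝ) = h + (2 * c + 1) := by exact_mod_cast hh
    have hm0 : (0 : ℝ) ≤ m := Nat.cast_nonneg _
    have e5 : (m : ℝ) * (L - (2 * c + 1)) ≤ m * (h + 1) :=
      mul_le_mul_of_nonneg_left (by linarith) hm0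
    have e6 : ((P.coeff 1).natDegree : ℝ) + c ≤
        (w - n + 1) * L + (1 + (n - 1) * (2 * c + 1) + c) := by
      rw [e3]
      nlinarith
    have e7 := mul_le_mul_of_nonneg_left e6 hw'.le
    nlinarith

theorem le_wnstar (ξ : K Fq) (n : ℕ) (A : ℝ) (hA : 0 < A)
    (h : ∀ w, 0 < w → w < A → w ∈ wnstarSet Fq ξ n) : (A : EReal) ≤ wnstar Fq ξ n := by
  by_contra hcon
  push Not at hcon
  obtain ⟨r, hr1, hr2⟩ := EReal.lt_iff_exists_real_btwn.mp hcon
  have hr2 : r < A := by exact_mod_cast hr2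
  have hmem := h (max r (A / 2)) (lt_of_lt_of_le (by linarith) (le_max_right _ _))
    (max_lt hr2 (by linarith))
  have hle : ((max r (A / 2) : ℝ) : EReal) ≤ wnstar Fq ξ n := le_sSup ⟨_, hmem, rfl⟩
  have : (r : EReal) ≤ ((max r (A / 2) : ℝ) : EReal) := by exact_mod_cast le_max_left _ _
  exact absurd (this.trans hle) (not_le.mpr hr1)

end helpers

/-- `w_n^*(ξ) ≥ ŵ_n(ξ)/(ŵ_n(ξ) - n + 1)`, the right-hand side being
interpreted as `1` when `ŵ_n(ξ) = ∞`. -/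
theorem wirsing_uniform (Fq : Type) [Field Fq] [Fintype Fq]
    (n : ℕ) (hn : 1 ≤ n) (ξ : K Fq) (hnotalg : ¬ IsAlgDegLe Fq ξ n) :
    (if hwn Fq ξ n = ⊤ then (1 : EReal)
      else (((hwn Fq ξ n).toReal / ((hwn Fq ξ n).toReal - n + 1) : ℝ) : EReal))
      ≤ wnstar Fq ξ n := by
  split_ifs with htop
  · have := le_wnstar Fq ξ n 1 one_pos (mem_wnstar_one Fq ξ n hn hnotalg)
    exact_mod_cast this
  · have hge : ((n : ℝ) : EReal) ≤ hwn Fq ξ n := by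
      by_contra hcon
      push Not at hcon
      obtain ⟨r, hr1, hr2⟩ := EReal.lt_iff_exists_real_btwn.mp hcon
      have hr2 : r < n := by exact_mod_cast hr2
      have hle : (r : EReal) ≤ hwn Fq ξ n :=
        le_sSup ⟨r, mem_hwn Fq ξ n hn hnotalg r hr2, rfl⟩
      exact absurd hle (not_le.mpr hr1)
    have hbot : hwn Fq ξ n ≠ ⊥ := by
      intro h
      rw [h] at hge
      exact absurd hge (not_le.mpr (EReal.bot_lt_coe _))
    set W := (hwn Fq ξ n).toReal with hW
    have hWc : hwn Fq ξ n = (W : EReal) := (EReal.coe_toReal htop hbot).symm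
    rw [hWc] at hge
    have hge : (n : ℝ) ≤ W := by exact_mod_cast hge
    have hn1 : (1 : ℝ) ≤ n := by exact_mod_cast hn
    have hden : 0 < W - n + 1 := by linarith
    apply le_wnstar Fq ξ n _ (div_pos (by linarith) hden)
    intro w' hw' hlt
    rw [lt_div_iff₀ hden] at hlt
    set δ := (W - w' * (W - n + 1)) / (w' + 1) with hδ
    have hδ0 : 0 < δ := div_pos (by linarith) (by linarith)
    have hδ1 : δ * (w' + 1) = W - w' * (W - n + 1) := div_mul_cancel₀ _ (by linarith)
    apply mem_wnstar_main Fq ξ n hn hnotalg (W + δ) w' _ (by linarith) hw' (by nlinarith)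
    intro hmem
    have hle : ((W + δ : ℝ) : EReal) ≤ hwn Fq ξ n := le_sSup ⟨_, hmem, rfl⟩
    rw [hWc] at hle
    have hle : W + δ ≤ W := by exact_mod_cast hle
    linarith

end
end MahlerKoksmaFq
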